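/- Let d ≥ 0 be a fixed integer. Then for every real c < (2/(π·e))^{d/2} there exists N such that for all integers n ≥ N with n − d equal to the order of some Hadamard matrix, D̄(n) > c; that is, the liminf of D̄(n) over n → ∞ with n − d an order of a Hadamard matrix is at least (2/(π·e))^{d/2}. -/

import Mathlib

/-- An `h × h` Hadamard matrix: entries in `{−1, 1}` and `A * Aᵀ = h • I`. -/
def IsHadamardMatrix {h : ℕ} (A : Matrix (Fin h) (Fin h) ℝ) : Prop :=
  (∀ i j, A i j = 1 ∨ A i j = -1) ∧ A * A.transpose = (h : ℝ) • 1

/-- `h` is the order of some Hadamard matrix. -/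
def IsHadamardOrder (h : ℕ) : Prop :=
  ∃ A : Matrix (Fin h) (Fin h) ℝ, IsHadamardMatrix A

/-- `maxDet n = D(n)`: the maximum of `|det M|` over `n × n` `{±1}`-matrices `M`. -/
noncomputable def maxDet (n : ℕ) : ℝ :=
  sSup {x : ℝ | ∃ M : Matrix (Fin n) (Fin n) ℝ,
    (∀ i j, M i j = 1 ∨ M i j = -1) ∧ x = |M.det|}

/-- `maxDetBar n = D̄(n) = D(n) / n^(n/2)`. -/
noncomputable def maxDetBar (n : ℕ) : ℝ :=
  maxDet n / (n : ℝ) ^ ((n : ℝ) / 2)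

open Finset Matrix

/-- If every row of `g` has average at most `c`, so has `g (B i) (B j)` over all `B`. -/
theorem sum_pair_le {X ι : Type*} [Fintype X] [Fintype ι] [DecidableEq ι]
    (g : X → X → ℝ) (c : ℝ) (hg : ∀ x, ∑ y, g x y ≤ Fintype.card X * c) {i j : ι} (hij : i ≠ j) :
    ∑ B : ι → X, g (B i) (B j) ≤ (Fintype.card X : ℝ) ^ Fintype.card ι * c := by
  classical
  rw [← (Equiv.funSplitAt j X).symm.sum_comp, Fintype.sum_prod_type_right]
  have hcard : (Fintype.card X : ℝ) ^ Fintype.card ι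
      = Fintype.card ({k // k ≠ j} → X) * Fintype.card X := by
    have h := Fintype.card_congr (Equiv.funSplitAt j X)
    rw [Fintype.card_prod, mul_comm, Fintype.card_fun] at h
    exact_mod_cast h
  calc _ ≤ ∑ _r : {k // k ≠ j} → X, (Fintype.card X : ℝ) * c := by
        refine sum_le_sum fun r _ => ?_
        simpa [Equiv.funSplitAt, Equiv.piSplitAt, hij] using hg (r ⟨i, hij⟩)
    _ = _ := by
        rw [hcard, sum_const, card_univ, nsmul_eq_mul, mul_assoc]

/-- A determinant is at least its diagonal product minus the other terms of the expansion. -/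
theorem prod_diag_sub_le_det {ι : Type*} [Fintype ι] [DecidableEq ι] (K : Matrix ι ι ℝ) :
    ∏ i, K i i - ∑ σ ∈ (univ : Finset (Equiv.Perm ι)).erase 1, ∏ i, |K (σ i) i| ≤ K.det := by
  rw [det_apply', ← add_sum_erase _ _ (mem_univ (1 : Equiv.Perm ι))]
  simp only [Equiv.Perm.sign_one, Units.val_one, Int.cast_one, one_mul, Equiv.Perm.coe_one, id_eq]
  rw [sub_eq_add_neg, ← sum_neg_distrib]
  gcongr with σ _
  rw [← abs_prod]
  rcases Int.units_eq_one_or (Equiv.Perm.sign σ) with h | h <;> simp [h]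
  · exact neg_abs_le _
  · exact le_abs_self _

/-- The random matrix `f (B i) (B j) + 1` has a large determinant for some choice of `B`, if `f` is
large on average on the diagonal and has bounded second moments off the diagonal. -/
theorem exists_det_ge {X : Type*} [Fintype X] [Nonempty X] (d : ℕ) (f : X → X → ℝ) (s μ : ℝ)
    (hs : 1 ≤ s) (hpos : ∀ x, 0 ≤ f x x) (hbd : ∀ x y, |f x y| ≤ s)
    (hsq : ∀ x, ∑ y, f x y ^ 2 ≤ Fintype.card X)
    (hμ : ∑ x, f x x = Fintype.card X * μ) :
    ∃ B : Fin d → X, μ ^ d - d.factorial * ((2 * s) ^ d / s)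
      ≤ (Matrix.of fun i j => f (B i) (B j) + 1).det := by
  classical
  set q : ℝ := (Fintype.card X : ℝ) ^ d
  have hs0 : 0 < s := by linarith
  have hK : ∀ x y, |f x y + 1| ≤ 2 * s := fun x y =>
    (abs_add_le _ _).trans (by rw [abs_one]; linarith [hbd x y])
  have hrow : ∀ x, ∑ y, |f x y + 1| ≤ Fintype.card X * 2 := by
    intro x
    calc ∑ y, |f x y + 1| ≤ ∑ y, (f x y ^ 2 / 2 + 3 / 2) := by
          refine sum_le_sum fun y _ => ?_
          rw [abs_le]
          constructor <;> nlinarith [sq_nonneg (f x y - 1), sq_nonneg (f x y + 1)]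
      _ ≤ _ := by
          rw [sum_add_distrib, ← sum_div, sum_const, card_univ, nsmul_eq_mul]
          linarith [hsq x]
  have hdiag : q * μ ^ d = ∑ B : Fin d → X, ∏ i, f (B i) (B i) := by
    rw [← Fintype.sum_pow (fun x => f x x), hμ, mul_pow]
  have hoff : ∀ σ ∈ (univ : Finset (Equiv.Perm (Fin d))).erase 1,
      ∑ B : Fin d → X, ∏ i, |f (B (σ i)) (B i) + 1| ≤ q * ((2 * s) ^ d / s) := by
    intro σ hσ
    obtain ⟨j, hj⟩ : ∃ j, σ j ≠ j := by
      by_contra! h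
      exact (mem_erase.1 hσ).1 (Equiv.ext h)
    have hd : (2 * s) ^ (univ.erase j).card = (2 * s) ^ d / s / 2 := by
      have h := card_erase_add_one (mem_univ j)
      rw [card_univ, Fintype.card_fin] at h
      conv_rhs => rw [← h, pow_succ]
      field_simp
    calc _ ≤ ∑ B : Fin d → X, |f (B (σ j)) (B j) + 1| * ((2 * s) ^ d / s / 2) := by
          refine sum_le_sum fun B _ => ?_
          rw [← mul_prod_erase _ _ (mem_univ j), ← hd]
          gcongr
          exact (prod_le_prod (fun _ _ => abs_nonneg _) fun i _ => hK _ _).trans_eq (prod_const _)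
      _ ≤ (q * 2) * ((2 * s) ^ d / s / 2) := by
          rw [← sum_mul]
          gcongr
          simpa [q] using sum_pair_le (fun x y => |f x y + 1|) 2 hrow hj
      _ = _ := by ring
  have hq : q = ∑ _B : Fin d → X, (1 : ℝ) := by simp [q]
  obtain ⟨B, -, hB⟩ := exists_le_of_sum_le (s := (univ : Finset (Fin d → X))) univ_nonempty
    (f := fun _ => μ ^ d - d.factorial * ((2 * s) ^ d / s))
    (g := fun B => (Matrix.of fun i j => f (B i) (B j) + 1).det) (by
      calc ∑ _B : Fin d → X, (μ ^ d - d.factorial * ((2 * s) ^ d / s))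
          = q * μ ^ d - d.factorial * (q * ((2 * s) ^ d / s)) := by
            simp [q]; ring
        _ ≤ ∑ B : Fin d → X, ∏ i, f (B i) (B i) -
            ∑ σ ∈ (univ : Finset (Equiv.Perm (Fin d))).erase 1,
              ∑ B : Fin d → X, ∏ i, |f (B (σ i)) (B i) + 1| := by
            rw [hdiag]
            gcongr
            refine (sum_le_card_nsmul _ _ _ hoff).trans ?_
            rw [nsmul_eq_mul]
            gcongr
            refine (card_erase_le).trans ?_
            rw [card_univ, Fintype.card_perm, Fintype.card_fin]
        _ = ∑ B : Fin d → X, (∏ i, f (B i) (B i) -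
            ∑ σ ∈ (univ : Finset (Equiv.Perm (Fin d))).erase 1,
              ∏ i, |f (B (σ i)) (B i) + 1|) := by
            rw [sum_sub_distrib, sum_comm]
        _ ≤ _ := by
            refine sum_le_sum fun B _ => le_trans ?_ (prod_diag_sub_le_det _)
            simp only [of_apply]
            gcongr with i
            · intro i _
              exact hpos _
            · linarith)
  exact ⟨B, hB⟩

theorem sum_range_choose_mul_sub (n K : ℕ) (hK : K ≤ n + 1) :
    ∑ k ∈ range K, (n.choose k : ℝ) * (n - 2 * k) = K * n.choose K := by
  induction K with
  | zero => simp
  | succ k ih =>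
    rw [sum_range_succ, ih (by omega)]
    have h : ((n.choose (k + 1) * (k + 1) : ℕ) : ℝ) = (n.choose k * (n - k) : ℕ) := by
      rw [Nat.choose_succ_right_eq]
    push_cast [Nat.cast_sub (show k ≤ n by omega)] at h
    push_cast
    linarith

theorem sum_range_choose_mul_abs (m : ℕ) :
    (2 * m : ℝ) * m.centralBinom
      ≤ ∑ k ∈ range (2 * m + 1), ((2 * m).choose k : ℝ) * |2 * (k : ℝ) - (2 * m : ℕ)| := by
  have h1 := sum_range_choose_mul_sub (2 * m) m (by omega)
  have h2 := sum_range_choose_mul_sub (2 * m) (2 * m + 1) le_rfl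
  rw [Nat.choose_succ_self, Nat.cast_zero, mul_zero] at h2
  have h3 : ∑ k ∈ range m, ((2 * m).choose k : ℝ) * ((2 * m : ℕ) - 2 * k)
      ≤ ∑ k ∈ range (2 * m + 1),
        ((2 * m).choose k : ℝ) * max (((2 * m : ℕ) : ℝ) - 2 * k) 0 := by
    refine (sum_le_sum fun k _ => mul_le_mul_of_nonneg_left (le_max_left _ 0)
      (Nat.cast_nonneg _)).trans ?_
    exact sum_le_sum_of_subset_of_nonneg (range_subset_range.2 (by omega)) fun k _ _ => by positivity
  have h4 : ∑ k ∈ range (2 * m + 1), ((2 * m).choose k : ℝ) * |2 * (k : ℝ) - (2 * m : ℕ)|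
      = 2 * ∑ k ∈ range (2 * m + 1), ((2 * m).choose k : ℝ) * max (((2 * m : ℕ) : ℝ) - 2 * k) 0
        - ∑ k ∈ range (2 * m + 1), ((2 * m).choose k : ℝ) * ((2 * m : ℕ) - 2 * k) := by
    rw [mul_sum, ← sum_sub_distrib]
    refine sum_congr rfl fun k _ => ?_
    rw [abs_sub_comm]
    rcases le_total 0 (((2 * m : ℕ) : ℝ) - 2 * k) with h | h
    · rw [abs_of_nonneg h, max_eq_left h]; ring
    · rw [abs_of_nonpos h, max_eq_right h]; ring
  rw [h4, h2, Nat.centralBinom]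
  linarith

/-- The sign vectors indexed by `ι` correspond to subsets of `ι`. -/
def signEquivFinset (ι : Type*) [Fintype ι] [DecidableEq ι] : (ι → ℤˣ) ≃ Finset ι where
  toFun b := univ.filter fun i => b i = 1
  invFun s i := if i ∈ s then 1 else -1
  left_inv b := by
    ext i
    rcases Int.units_eq_one_or (b i) with h | h <;> simp [h]
  right_inv s := by
    ext i
    simp only [mem_filter, mem_univ, true_and, ite_eq_left_iff]
    by_cases h : i ∈ s <;> simp [h]

theorem sum_abs_sum_sign_ge (m : ℕ) :
    (2 * m : ℝ) * m.centralBinom ≤ ∑ b : Fin (2 * m) → ℤˣ, |∑ i, ((b i : ℤ) : ℝ)| := by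
  rw [← (signEquivFinset _).symm.sum_comp]
  have h : ∀ s : Finset (Fin (2 * m)),
      ∑ i, ((((signEquivFinset _).symm s i : ℤˣ) : ℤ) : ℝ) = 2 * (s.card : ℝ) - (2 * m : ℕ) := by
    intro s
    have : ∀ i, ((((signEquivFinset _).symm s i : ℤˣ) : ℤ) : ℝ) = 2 * (if i ∈ s then 1 else 0) - 1 := by
      intro i
      simp only [signEquivFinset, Equiv.coe_fn_symm_mk]
      split_ifs <;> norm_num
    simp only [this]
    rw [sum_sub_distrib, ← mul_sum, sum_boole]
    simp
  simp only [h]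
  rw [← powerset_univ,
    sum_powerset_apply_card (fun k => |2 * (k : ℝ) - (2 * m : ℕ)|) (x := (univ : Finset (Fin (2 * m))))]
  simpa only [card_univ, Fintype.card_fin, nsmul_eq_mul] using sum_range_choose_mul_abs m

theorem centralBinom_ge (m : ℕ) :
    4 ^ m * √(2 / Real.pi * (1 / (2 * m + 1))) ≤ (m.centralBinom : ℝ) := by
  have hW := Real.Wallis.W_le m
  rw [Real.Wallis.W_eq_factorial_ratio] at hW
  have hf : ((2 * m).factorial : ℝ) = m.centralBinom * m.factorial ^ 2 := by
    have := Nat.choose_mul_factorial_mul_factorial (show m ≤ 2 * m by omega)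
    rw [show 2 * m - m = m by omega] at this
    rw [← this, Nat.centralBinom]
    push_cast
    ring
  have hm : (0 : ℝ) < m.factorial := by positivity
  have hc : (0 : ℝ) < m.centralBinom := by exact_mod_cast m.centralBinom_pos
  have hpi := Real.pi_pos
  rw [hf, div_le_iff₀ (by positivity)] at hW
  have key : (4 ^ m : ℝ) ^ 2 ≤ Real.pi / 2 * (m.centralBinom ^ 2 * (2 * m + 1)) := by
    have h4 : (4 ^ m : ℝ) ^ 2 = 2 ^ (4 * m) := by
      rw [← pow_mul, show (4 : ℝ) = 2 ^ 2 by norm_num, ← pow_mul]; ring_nf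
    rw [h4]
    refine le_of_mul_le_mul_right (hW.trans_eq ?_) (pow_pos hm 4)
    ring
  refine le_of_sq_le_sq ?_ hc.le
  rw [mul_pow, Real.sq_sqrt (by positivity)]
  calc _ ≤ (Real.pi / 2 * (m.centralBinom ^ 2 * (2 * m + 1))) * (2 / Real.pi * (1 / (2 * m + 1))) := by
        gcongr
    _ = _ := by field_simp

/-- A vector of signs as a real vector. -/
def signVec {ι : Type*} (b : ι → ℤˣ) : ι → ℝ := fun i => ((b i : ℤ) : ℝ)

theorem signVec_mul_self {ι : Type*} (b : ι → ℤˣ) (i : ι) : signVec b i * signVec b i = 1 := by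
  rcases Int.units_eq_one_or (b i) with h | h <;> simp [signVec, h]

theorem signVec_eq {ι : Type*} (b : ι → ℤˣ) (i : ι) : signVec b i = 1 ∨ signVec b i = -1 := by
  rcases Int.units_eq_one_or (b i) with h | h <;> simp [signVec, h]

theorem signVec_dotProduct_self {ι : Type*} [Fintype ι] (b : ι → ℤˣ) :
    signVec b ⬝ᵥ signVec b = Fintype.card ι := by
  simp [dotProduct, signVec_mul_self]

theorem sum_signVec_mul {ι : Type*} [Fintype ι] [DecidableEq ι] {k l : ι} (hkl : k ≠ l) :
    ∑ b : ι → ℤˣ, signVec b k * signVec b l = 0 := by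
  have h := Fintype.sum_equiv (Equiv.mulLeft (Pi.mulSingle k (-1) : ι → ℤˣ)) _
    (fun b => signVec b k * signVec b l) fun _ => rfl
  simp only [signVec, Equiv.coe_mulLeft, Pi.mul_apply, Pi.mulSingle_eq_same,
    Pi.mulSingle_eq_of_ne hkl.symm, one_mul, neg_mul, Units.val_neg, Int.cast_neg,
    sum_neg_distrib] at h ⊢
  linarith

theorem sum_dotProduct_signVec_sq {ι : Type*} [Fintype ι] [DecidableEq ι] (v : ι → ℝ) :
    ∑ b : ι → ℤˣ, (v ⬝ᵥ signVec b) ^ 2 = Fintype.card (ι → ℤˣ) * (v ⬝ᵥ v) := by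
  have h : ∀ b : ι → ℤˣ, (v ⬝ᵥ signVec b) ^ 2
      = ∑ k, ∑ l, v k * v l * (signVec b k * signVec b l) := by
    intro b
    rw [sq, dotProduct, sum_mul_sum]
    exact sum_congr rfl fun k _ => sum_congr rfl fun l _ => by ring
  simp only [h]
  rw [sum_comm, dotProduct, mul_sum]
  refine sum_congr rfl fun k _ => ?_
  rw [sum_comm, sum_eq_single k]
  · rw [← mul_sum]
    simp only [signVec_mul_self, sum_const, card_univ, nsmul_eq_mul, mul_one]
    ring
  · intro l _ hl
    rw [← mul_sum, sum_signVec_mul hl.symm, mul_zero]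
  · simp

/-- The signs of the coordinates of `v`. -/
noncomputable def coordSign {ι : Type*} (v : ι → ℝ) : ι → ℤˣ := fun k => if 0 ≤ v k then 1 else -1

theorem signVec_coordSign_dotProduct {ι : Type*} [Fintype ι] (v : ι → ℝ) :
    signVec (coordSign v) ⬝ᵥ v = ∑ k, |v k| := by
  refine sum_congr rfl fun k _ => ?_
  simp only [signVec, coordSign]
  split_ifs with h
  · simp [abs_of_nonneg h]
  · simp [abs_of_neg (not_le.1 h)]

theorem sum_abs_dotProduct_signVec {ι : Type*} [Fintype ι] [DecidableEq ι] (a : ι → ℤˣ) :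
    ∑ b : ι → ℤˣ, |signVec a ⬝ᵥ signVec b| = ∑ b : ι → ℤˣ, |∑ i, ((b i : ℤ) : ℝ)| := by
  refine Fintype.sum_equiv (Equiv.mulLeft a) _ _ fun b => ?_
  simp [dotProduct, signVec]

theorem IsHadamardMatrix.exists_signVec {h : ℕ} {A : Matrix (Fin h) (Fin h) ℝ}
    (hA : IsHadamardMatrix A) : ∃ a : Fin h → Fin h → ℤˣ, ∀ i, A i = signVec (a i) := by
  refine ⟨fun i => coordSign (A i), fun i => funext fun j => ?_⟩
  rcases hA.1 i j with hij | hij <;> norm_num [signVec, coordSign, hij]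

theorem IsHadamardMatrix.transpose_mul_self {h : ℕ} {A : Matrix (Fin h) (Fin h) ℝ}
    (hA : IsHadamardMatrix A) : Aᵀ * A = (h : ℝ) • 1 := by
  rcases Nat.eq_zero_or_pos h with rfl | hh
  · exact Subsingleton.elim _ _
  have h0 : (h : ℝ) ≠ 0 := by positivity
  have h1 : A * ((h : ℝ)⁻¹ • Aᵀ) = 1 := by
    rw [mul_smul_comm, hA.2, smul_smul, inv_mul_cancel₀ h0, one_smul]
  have h2 := mul_eq_one_comm.1 h1
  rw [smul_mul_assoc] at h2
  rw [← h2, smul_smul, mul_inv_cancel₀ h0, one_smul]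

theorem IsHadamardMatrix.transpose {h : ℕ} {A : Matrix (Fin h) (Fin h) ℝ}
    (hA : IsHadamardMatrix A) : IsHadamardMatrix Aᵀ :=
  ⟨fun i j => hA.1 j i, by rw [transpose_transpose, hA.transpose_mul_self]⟩

theorem IsHadamardMatrix.mulVec_dotProduct_self {h : ℕ} {A : Matrix (Fin h) (Fin h) ℝ}
    (hA : IsHadamardMatrix A) (v : Fin h → ℝ) : (A *ᵥ v) ⬝ᵥ (A *ᵥ v) = h * (v ⬝ᵥ v) := by
  rw [dotProduct_mulVec, ← mulVec_transpose, mulVec_mulVec, hA.transpose_mul_self, smul_mulVec,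
    one_mulVec, smul_dotProduct, smul_eq_mul]

theorem IsHadamardMatrix.even {h : ℕ} (hh : 2 ≤ h) {A : Matrix (Fin h) (Fin h) ℝ}
    (hA : IsHadamardMatrix A) : Even h := by
  obtain ⟨a, ha⟩ := hA.exists_signVec
  let i : Fin h := ⟨0, by omega⟩
  let j : Fin h := ⟨1, by omega⟩
  have hij : i ≠ j := by simp [i, j, Fin.ext_iff]
  have h1 : (A * Aᵀ) i j = 0 := by rw [hA.2]; simp [hij]
  have h2 : ∑ k, ((a i k * a j k : ℤˣ) : ℤ) = 0 := by
    rw [mul_apply] at h1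
    simp only [transpose_apply, ha, signVec] at h1
    push_cast
    exact_mod_cast h1
  have h3 : ∀ u : ℤˣ, ((u : ℤ) : ZMod 2) = 1 := by
    intro u
    rcases Int.units_eq_one_or u with rfl | rfl <;> decide
  have h4 := congrArg (Int.cast : ℤ → ZMod 2) h2
  rw [Int.cast_sum] at h4
  simp only [h3, sum_const, card_univ, Fintype.card_fin, nsmul_eq_mul, mul_one, Int.cast_zero] at h4
  exact (ZMod.natCast_eq_zero_iff_even).1 h4

theorem IsHadamardMatrix.abs_det {h : ℕ} {A : Matrix (Fin h) (Fin h) ℝ}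
    (hA : IsHadamardMatrix A) : |A.det| = √((h : ℝ) ^ h) := by
  have h1 := congrArg det hA.2
  rw [det_mul, det_transpose, det_smul, det_one, mul_one, Fintype.card_fin, ← sq] at h1
  rw [← h1, Real.sqrt_sq_eq_abs]

theorem abs_det_le_maxDet {n : ℕ} (M : Matrix (Fin n) (Fin n) ℝ)
    (hM : ∀ i j, M i j = 1 ∨ M i j = -1) : |M.det| ≤ maxDet n := by
  refine le_csSup ⟨n.factorial, ?_⟩ ⟨M, hM, rfl⟩
  rintro x ⟨M, hM, rfl⟩
  have := det_le (A := M) (abv := AbsoluteValue.abs) (x := 1) fun i j => by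
    rcases hM i j with h | h <;> simp [h]
  simpa using this

/-- Border a Hadamard matrix by columns `b`, rows `c` and a corner with all entries `-1`. -/
theorem IsHadamardMatrix.le_maxDet {h d : ℕ} (hh : 0 < h) {A : Matrix (Fin h) (Fin h) ℝ}
    (hA : IsHadamardMatrix A) (b c : Fin d → Fin h → ℤˣ) :
    √((h : ℝ) ^ h) * (Matrix.of fun i j =>
      (A *ᵥ signVec (c i)) ⬝ᵥ signVec (b j) / h + 1).det ≤ maxDet (d + h) := by
  have h0 : (h : ℝ) ≠ 0 := by positivity
  have h1 : A * ((h : ℝ)⁻¹ • Aᵀ) = 1 := by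
    rw [mul_smul_comm, hA.2, smul_smul, inv_mul_cancel₀ h0, one_smul]
  let iA : Invertible A := invertibleOfRightInverse _ _ h1
  let M := fromBlocks A (of fun i j => signVec (b j) i) (of fun i j => signVec (c i) j)
    (of fun _ _ => -1)
  have hdet : M.det = A.det * (-(Matrix.of fun i j =>
      (A *ᵥ signVec (c i)) ⬝ᵥ signVec (b j) / h + 1 : Matrix (Fin d) (Fin d) ℝ)).det := by
    rw [det_fromBlocks₁₁]
    congr 2
    ext i j
    have : ⅟A = (h : ℝ)⁻¹ • Aᵀ := rfl
    rw [this, Matrix.mul_smul, Matrix.smul_mul, Matrix.sub_apply, Matrix.smul_apply, mul_apply]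
    simp only [of_apply, Matrix.neg_apply, mul_apply, transpose_apply, dotProduct, mulVec, smul_eq_mul,
      mul_comm (signVec (c i) _)]
    ring
  let e : Fin h ⊕ Fin d ≃ Fin (d + h) := finSumFinEquiv.trans (finCongr (add_comm h d))
  have hle := abs_det_le_maxDet (reindex e e M) fun i j => by
    rw [reindex_apply, submatrix_apply]
    rcases e.symm i with i | i <;> rcases e.symm j with j | j
    · exact hA.1 _ _
    · exact signVec_eq _ _
    · exact signVec_eq _ _
    · exact Or.inr rfl
  rw [det_reindex_self, hdet, det_neg, abs_mul, abs_mul, hA.abs_det, abs_pow] at hle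
  simp only [abs_neg, abs_one, one_pow, one_mul] at hle
  exact (mul_le_mul_of_nonneg_left (le_abs_self _) (Real.sqrt_nonneg _)).trans hle

theorem IsHadamardMatrix.maxDet_ge {h d : ℕ} (hh : 2 ≤ h) {A : Matrix (Fin h) (Fin h) ℝ}
    (hA : IsHadamardMatrix A) :
    √((h : ℝ) ^ h) * ((h * √(2 / Real.pi * (1 / (h + 1)))) ^ d
      - d.factorial * ((2 * √h) ^ d / √h)) ≤ maxDet (d + h) := by
  obtain ⟨m, hm⟩ := (hA.even hh).two_dvd
  obtain ⟨a, ha⟩ := hA.transpose.exists_signVec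
  have h0 : (0 : ℝ) < h := by positivity
  let c : (Fin h → ℤˣ) → (Fin h → ℤˣ) := fun x => coordSign (Aᵀ *ᵥ signVec x)
  let f : (Fin h → ℤˣ) → (Fin h → ℤˣ) → ℝ := fun x y => (A *ᵥ signVec (c x)) ⬝ᵥ signVec y / h
  have hAc : ∀ x, (A *ᵥ signVec (c x)) ⬝ᵥ (A *ᵥ signVec (c x)) = (h : ℝ) ^ 2 := fun x => by
    rw [hA.mulVec_dotProduct_self, signVec_dotProduct_self, Fintype.card_fin, sq]
  have hdiag : ∀ x, f x x = (∑ k, |(Aᵀ *ᵥ signVec x) k|) / h := fun x => by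
    rw [← signVec_coordSign_dotProduct, dotProduct_mulVec, vecMul_transpose]
  have hmean : (∑ x, f x x) = ∑ b : Fin h → ℤˣ, |∑ i, ((b i : ℤ) : ℝ)| := by
    simp only [hdiag]
    rw [← sum_div, sum_comm]
    have : ∀ k x, (Aᵀ *ᵥ signVec x) k = signVec (a k) ⬝ᵥ signVec x := fun k x => by
      rw [← ha k]; rfl
    simp only [this, sum_abs_dotProduct_signVec]
    rw [sum_const, card_univ, Fintype.card_fin, nsmul_eq_mul]
    field_simp
  set N : ℝ := (Fintype.card (Fin h → ℤˣ) : ℝ) with hN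
  have hN4 : N = 4 ^ m := by
    simp [hN, hm, pow_mul]
  have hN0 : 0 < N := by rw [hN4]; positivity
  obtain ⟨B, hB⟩ := exists_det_ge d f (√h) ((∑ x, f x x) / N)
    (Real.one_le_sqrt.2 (by exact_mod_cast (by omega : 1 ≤ h)))
    (fun x => by rw [hdiag]; positivity)
    (fun x y => by
      refine Real.abs_le_sqrt ?_
      have h1 := sum_mul_sq_le_sq_mul_sq univ (A *ᵥ signVec (c x)) (signVec y)
      have h2 := hAc x
      have h3 := signVec_dotProduct_self y
      simp only [dotProduct, ← sq, Fintype.card_fin] at h2 h3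
      rw [h2, h3] at h1
      simp only [f, div_pow, dotProduct]
      rw [div_le_iff₀ (by positivity)]
      linarith)
    (fun x => by
      simp only [f, div_pow]
      rw [← sum_div, sum_dotProduct_signVec_sq, hAc, mul_div_cancel_right₀ _ (by positivity)])
    (by rw [mul_div_cancel₀ _ hN0.ne'])
  refine le_trans ?_ (hA.le_maxDet (by omega) B fun i => c (B i))
  refine mul_le_mul_of_nonneg_left (le_trans ?_ hB) (Real.sqrt_nonneg _)
  gcongr
  rw [le_div_iff₀ hN0, hmean]
  have hsum := sum_abs_sum_sign_ge m
  rw [← hm] at hsum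
  refine le_trans ?_ hsum
  have hhm : (h : ℝ) = 2 * m := by exact_mod_cast hm
  rw [hN4, hhm, mul_assoc, mul_comm √_]
  gcongr
  exact centralBinom_ge m

theorem sqrt_pow_eq (x : ℝ) (k : ℕ) (hx : 0 ≤ x) : √(x ^ k) = √x ^ k := by
  rw [Real.sqrt_eq_iff_eq_sq (by positivity) (by positivity), ← pow_mul, mul_comm, pow_mul,
    Real.sq_sqrt hx]

theorem tendsto_lower_bound (d : ℕ) :
    Filter.Tendsto (fun h : ℕ => √((h : ℝ) ^ h) * ((h * √(2 / Real.pi * (1 / (h + 1)))) ^ d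
      - d.factorial * ((2 * √h) ^ d / √h)) / √(((d + h : ℕ) : ℝ) ^ (d + h))) Filter.atTop
      (nhds (√((2 / (Real.pi * Real.exp 1)) ^ d))) := by
  have hinv : Filter.Tendsto (fun h : ℕ => 1 / ((h : ℝ) + 1)) Filter.atTop (nhds 0) :=
    tendsto_one_div_add_atTop_nhds_zero_nat
  have h1 : Filter.Tendsto (fun h : ℕ => √((1 + (-d : ℝ) / ((h + d : ℕ) : ℝ)) ^ (h + d)))
      Filter.atTop (nhds √(Real.exp (-d))) :=
    ((Real.tendsto_one_add_div_pow_exp (-d : ℝ)).comp (Filter.tendsto_add_atTop_nat d)).sqrt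
  have h2 : Filter.Tendsto (fun h : ℕ => (√(2 / Real.pi * (1 - 1 / ((h : ℝ) + 1)))) ^ d
      - d.factorial * (2 ^ d * (√(h : ℝ))⁻¹)) Filter.atTop
      (nhds ((√(2 / Real.pi * (1 - 0))) ^ d - d.factorial * (2 ^ d * 0))) := by
    refine Filter.Tendsto.sub (((hinv.const_sub 1).const_mul _).sqrt.pow d)
      (((Filter.Tendsto.inv_tendsto_atTop ?_).const_mul _).const_mul _)
    exact Real.tendsto_sqrt_atTop.comp tendsto_natCast_atTop_atTop
  have hlim : √((2 / (Real.pi * Real.exp 1)) ^ d)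
      = √(Real.exp (-d)) * ((√(2 / Real.pi * (1 - 0))) ^ d - d.factorial * (2 ^ d * 0)) := by
    have hpi := Real.pi_pos
    rw [mul_zero, mul_zero, sub_zero, sub_zero, mul_one, ← sqrt_pow_eq (2 / Real.pi) d (by positivity),
      ← Real.sqrt_mul (Real.exp_nonneg _), Real.exp_neg, ← Real.exp_one_pow, ← inv_pow, ← mul_pow]
    congr 2
    field_simp
  rw [hlim]
  refine (h1.mul h2).congr' ?_
  filter_upwards [Filter.eventually_ge_atTop 1] with h hh
  have h0 : (0 : ℝ) < h := by positivity
  have hr : 0 < √(h : ℝ) := Real.sqrt_pos.2 h0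
  have hQ : (h : ℝ) * √(2 / Real.pi * (1 / (h + 1)))
      = √(h : ℝ) * √(2 / Real.pi * (1 - 1 / ((h : ℝ) + 1))) := by
    rw [← Real.sqrt_mul h0.le, ← Real.sqrt_sq h0.le, ← Real.sqrt_mul (by positivity),
      Real.sqrt_sq h0.le]
    congr 1
    field_simp
    ring
  have hfrac : (1 + (-d : ℝ) / ((h + d : ℕ) : ℝ)) = h / ((d + h : ℕ) : ℝ) := by
    push_cast
    field_simp
    ring
  have hpow : √((h : ℝ) ^ (h + d)) = √((h : ℝ) ^ h) * √(h : ℝ) ^ d := by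
    rw [pow_add, Real.sqrt_mul (by positivity), sqrt_pow_eq _ d h0.le]
  rw [hfrac, div_pow, Real.sqrt_div (by positivity), hpow, hQ, add_comm h d, mul_pow, mul_pow]
  field_simp

theorem maxDetBar_liminf (d : ℕ) :
    ∀ c : ℝ, c < (2 / (Real.pi * Real.exp 1)) ^ ((d : ℝ) / 2) →
      ∃ N : ℕ, ∀ n : ℕ, N ≤ n → IsHadamardOrder (n - d) → maxDetBar n > c := by
  intro c hc
  have hsqrt : ∀ (x : ℝ) (k : ℕ), 0 ≤ x → x ^ ((k : ℝ) / 2) = √(x ^ k) := fun x k hx => by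
    rw [Real.sqrt_eq_rpow, ← Real.rpow_natCast, ← Real.rpow_mul hx]
    ring_nf
  rw [hsqrt _ _ (by positivity)] at hc
  obtain ⟨N, hN⟩ := Filter.eventually_atTop.1 ((tendsto_lower_bound d).eventually_const_lt hc)
  refine ⟨d + max N 2, fun n hn hord => ?_⟩
  obtain ⟨h, rfl⟩ := Nat.exists_eq_add_of_le (show d ≤ n by omega)
  rw [Nat.add_sub_cancel_left] at hord
  obtain ⟨A, hA⟩ := hord
  refine (hN h (by omega)).trans_le ?_
  rw [maxDetBar, hsqrt _ _ (Nat.cast_nonneg _)]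
  gcongr
  exact hA.maxDet_ge (by omega)
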